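/- Let Λ₁ be the set of vectors in the Euclidean plane ℝ² of the form m·(√3, 0) + n·(√3/2, 3/2) with m, n ∈ ℤ (the triangular lattice of edge length √3), and let Λ₂ be the set of vectors of the form p·(1,0) + q·(1/2, √3/2) with p, q ∈ ℤ (the unit triangular lattice). Then there do not exist v ∈ Λ₁ and w ∈ Λ₂ with v ≠ 0 and ‖w‖² = (2/3)·‖v‖²; that is, a scale factor of √(2/3) is not possible between nonzero vectors of Λ₁ and vectors of Λ₂. -/

import Mathlib

noncomputable section

/-- The Euclidean plane. -/
abbrev Plane : Type := EuclideanSpace ℝ (Fin 2)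

/-- The vector `(√3, 0)` in the plane. -/
def f₁ : Plane := (WithLp.equiv 2 (Fin 2 → ℝ)).symm ![Real.sqrt 3, 0]

/-- The vector `(√3/2, 3/2)` in the plane. -/
def f₂ : Plane := (WithLp.equiv 2 (Fin 2 → ℝ)).symm ![Real.sqrt 3 / 2, 3 / 2]

/-- The vector `(1, 0)` in the plane. -/
def e₁ : Plane := (WithLp.equiv 2 (Fin 2 → ℝ)).symm ![1, 0]

/-- The vector `(1/2, √3/2)` in the plane. -/
def e₂ : Plane := (WithLp.equiv 2 (Fin 2 → ℝ)).symm ![1 / 2, Real.sqrt 3 / 2]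

/-- The triangular lattice of edge length `√3`. -/
def lattice₁ : Set Plane := {v : Plane | ∃ m n : ℤ, v = (m : ℝ) • f₁ + (n : ℝ) • f₂}

/-- The unit triangular lattice. -/
def lattice₂ : Set Plane := {v : Plane | ∃ p q : ℤ, v = (p : ℝ) • e₁ + (q : ℝ) • e₂}

/-- The form `x² + xy + y²` takes even values only at pairs of even integers. -/
theorem even_and_even_of_even_sq_add_mul_add_sq {x y : ℤ} (h : Even (x ^ 2 + x * y + y ^ 2)) :
    Even x ∧ Even y := by
  have key : Even (x ^ 2 + x * y + y ^ 2) ↔ Even x ∧ Even y := by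
    simp only [Int.even_add, Int.even_mul, Int.even_pow]
    tauto
  exact key.1 h

/-- A value of the form `x² + xy + y²` is twice another such value only if both vanish. -/
theorem eq_zero_of_sq_add_mul_add_sq_eq_two_mul (k : ℕ) (a b c d : ℤ)
    (hc : c ^ 2 + c * d + d ^ 2 = k) (ha : a ^ 2 + a * b + b ^ 2 = 2 * k) : k = 0 := by
  induction k using Nat.strong_induction_on generalizing a b c d with
  | _ k ih =>
    obtain ⟨⟨a', rfl⟩, ⟨b', rfl⟩⟩ :=
      even_and_even_of_even_sq_add_mul_add_sq (ha ▸ even_two_mul (k : ℤ))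
    have hk : 2 * (a' ^ 2 + a' * b' + b' ^ 2) = (k : ℤ) := by linarith
    obtain ⟨l, hl⟩ : ∃ l : ℕ, a' ^ 2 + a' * b' + b' ^ 2 = l :=
      Int.eq_ofNat_of_zero_le (by omega)
    by_contra hk0
    have := ih l (by omega) c d a' b' hl (by linarith)
    omega

/-- The squared norm on the triangular lattice of edge length `√3`. -/
theorem norm_sq_smul_f₁_add_smul_f₂ (x y : ℝ) :
    ‖x • f₁ + y • f₂‖ ^ 2 = 3 * (x ^ 2 + x * y + y ^ 2) := by
  have h3 : Real.sqrt 3 ^ 2 = 3 := Real.sq_sqrt (by norm_num)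
  simp only [EuclideanSpace.norm_sq_eq, Fin.sum_univ_two, Real.norm_eq_abs, sq_abs]
  simp [f₁, f₂]
  linear_combination (x + y / 2) ^ 2 * h3

/-- The squared norm on the unit triangular lattice. -/
theorem norm_sq_smul_e₁_add_smul_e₂ (x y : ℝ) :
    ‖x • e₁ + y • e₂‖ ^ 2 = x ^ 2 + x * y + y ^ 2 := by
  have h3 : Real.sqrt 3 ^ 2 = 3 := Real.sq_sqrt (by norm_num)
  simp only [EuclideanSpace.norm_sq_eq, Fin.sum_univ_two, Real.norm_eq_abs, sq_abs]
  simp [e₁, e₂]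
  linear_combination (y / 2) ^ 2 * h3

/-- A scale factor of `√(2/3)` is not possible between nonzero vectors of the
edge-`√3` triangular lattice and vectors of the unit triangular lattice. -/
theorem no_sqrt_two_thirds_scale_between_triangular_lattices :
    ¬ ∃ v ∈ lattice₁, ∃ w ∈ lattice₂, v ≠ 0 ∧ ‖w‖ ^ 2 = (2 / 3) * ‖v‖ ^ 2 := by
  rintro ⟨v, ⟨m, n, rfl⟩, w, ⟨p, q, rfl⟩, hv, h⟩
  have hpos := pow_pos (norm_pos_iff.2 hv) 2
  rw [norm_sq_smul_f₁_add_smul_f₂] at h hpos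
  rw [norm_sq_smul_e₁_add_smul_e₂] at h
  have hmn : 0 < m ^ 2 + m * n + n ^ 2 := by
    have : (0 : ℝ) < m ^ 2 + m * n + n ^ 2 := by linarith
    exact_mod_cast this
  have hpq : p ^ 2 + p * q + q ^ 2 = 2 * (m ^ 2 + m * n + n ^ 2) := by
    have : (p : ℝ) ^ 2 + p * q + q ^ 2 = 2 * (m ^ 2 + m * n + n ^ 2) := by linarith
    exact_mod_cast this
  obtain ⟨k, hk⟩ := Int.eq_ofNat_of_zero_le hmn.le
  have := eq_zero_of_sq_add_mul_add_sq_eq_two_mul k p q m n hk (hk ▸ hpq)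
  omega
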